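/- For every A ∈ B^{m,i}, all entries pr(A)_{1,r} (r = i,…,n) of the first column produced by the promotion algorithm are nonnegative integers, and moreover m − Σ_{r=i}^{n} pr(A)_{1,r} = Σ_{r=1}^{i} a_{r,n}. -/

import Mathlib

open Finset

namespace KR

/-- Arrays of integers indexed by (column, row). -/
abbrev Arr := ℕ → ℕ → ℤ

/-- A Dyck path from (1,i) to (i,n). -/
def IsDyck (n i : ℕ) (L : List (ℕ × ℕ)) : Prop :=
  L ≠ [] ∧ L.head? = some (1, i) ∧ L.getLast? = some (i, n) ∧
    L.Chain' (fun β γ => γ = (β.1, β.2 + 1) ∨ γ = (β.1 + 1, β.2))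

/-- Membership in the polytope `B^{m,i}`: nonnegative entries supported on the box
`1 ≤ p ≤ i`, `i ≤ q ≤ n`, with all Dyck path sums bounded by `m`. -/
def InB (n i m : ℕ) (A : Arr) : Prop :=
  (∀ p q, 1 ≤ p → p ≤ i → i ≤ q → q ≤ n → 0 ≤ A p q) ∧
  (∀ p q, ¬(1 ≤ p ∧ p ≤ i ∧ i ≤ q ∧ q ≤ n) → A p q = 0) ∧
  (∀ L, IsDyck n i L → (L.map fun β => A β.1 β.2).sum ≤ (m : ℤ))

/-- The sum `Σ_{j=1}^{p} a_{j,l−1} + Σ_{j=p}^{i} a_{j,l}` (used for `l > i`). -/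
def Fp (i : ℕ) (A : Arr) (l p : ℕ) : ℤ :=
  ∑ j ∈ Icc 1 p, A j (l - 1) + ∑ j ∈ Icc p i, A j l

/-- `p_+^l(A)`: minimal maximizer of `Fp` on `{1,…,i}`. -/
noncomputable def pplus (i : ℕ) (A : Arr) (l : ℕ) : ℕ :=
  sInf {p | p ∈ Icc 1 i ∧ ∀ q ∈ Icc 1 i, Fp i A l q ≤ Fp i A l p}

/-- `q_+^l(A)`: maximal maximizer of `Fp` on `{1,…,i}`. -/
noncomputable def qplus (i : ℕ) (A : Arr) (l : ℕ) : ℕ :=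
  sSup {p | p ∈ Icc 1 i ∧ ∀ q ∈ Icc 1 i, Fp i A l q ≤ Fp i A l p}

/-- The sum `Σ_{j=i}^{p} a_{l,j} + Σ_{j=p}^{n} a_{l+1,j}` (used for `l < i`). -/
def Fm (n i : ℕ) (A : Arr) (l p : ℕ) : ℤ :=
  ∑ j ∈ Icc i p, A l j + ∑ j ∈ Icc p n, A (l + 1) j

/-- `p_−^l(A)`: maximal maximizer of `Fm` on `{i,…,n}`. -/
noncomputable def pminus (n i : ℕ) (A : Arr) (l : ℕ) : ℕ :=
  sSup {p | p ∈ Icc i n ∧ ∀ q ∈ Icc i n, Fm n i A l q ≤ Fm n i A l p}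

/-- `q_−^l(A)`: minimal maximizer of `Fm` on `{i,…,n}`. -/
noncomputable def qminus (n i : ℕ) (A : Arr) (l : ℕ) : ℕ :=
  sInf {p | p ∈ Icc i n ∧ ∀ q ∈ Icc i n, Fm n i A l q ≤ Fm n i A l p}

/-- `φ_l(A)` (depending on the parameter `m` only when `l = i`). -/
noncomputable def phi (n i m : ℕ) (l : ℕ) (A : Arr) : ℤ :=
  if l = i then (m : ℤ) - ∑ j ∈ Icc 1 (i - 1), A j i - ∑ j ∈ Icc i n, A i j
  else if i < l then
    ∑ j ∈ Icc 1 (pplus i A l), A j (l - 1) - ∑ j ∈ Icc 1 (pplus i A l - 1), A j l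
  else
    ∑ j ∈ Icc (pminus n i A l) n, A (l + 1) j - ∑ j ∈ Icc (pminus n i A l + 1) n, A l j

/-- `ε_l(A)` (the parameter `m` is carried along for uniformity; it is not used). -/
noncomputable def eps (n i m : ℕ) (l : ℕ) (A : Arr) : ℤ :=
  if l = i then A i i
  else if i < l then
    ∑ j ∈ Icc (qplus i A l) i, A j l - ∑ j ∈ Icc (qplus i A l + 1) i, A j (l - 1)
  else
    ∑ j ∈ Icc i (qminus n i A l), A l j - ∑ j ∈ Icc i (qminus n i A l - 1), A (l + 1) j

/-- Update a single entry of an array. -/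
def upd (A : Arr) (p q : ℕ) (v : ℤ) : Arr :=
  fun p' q' => if p' = p ∧ q' = q then v else A p' q'

/-- The Kashiwara operator `f_l` (with `none` playing the role of `0`). -/
noncomputable def fop (n i m : ℕ) (l : ℕ) (A : Arr) : Option Arr :=
  if phi n i m l A = 0 then none
  else some <|
    if l = i then upd A i i (A i i + 1)
    else if i < l then
      upd (upd A (pplus i A l) (l - 1) (A (pplus i A l) (l - 1) - 1))
        (pplus i A l) l (A (pplus i A l) l + 1)
    else
      upd (upd A l (pminus n i A l) (A l (pminus n i A l) + 1))
        (l + 1) (pminus n i A l) (A (l + 1) (pminus n i A l) - 1)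

/-- The Kashiwara operator `e_l` (with `none` playing the role of `0`). -/
noncomputable def eop (n i m : ℕ) (l : ℕ) (A : Arr) : Option Arr :=
  if eps n i m l A = 0 then none
  else some <|
    if l = i then upd A i i (A i i - 1)
    else if i < l then
      upd (upd A (qplus i A l) (l - 1) (A (qplus i A l) (l - 1) + 1))
        (qplus i A l) l (A (qplus i A l) l - 1)
    else
      upd (upd A l (qminus n i A l) (A l (qminus n i A l) - 1))
        (l + 1) (qminus n i A l) (A (l + 1) (qminus n i A l) + 1)

/-- Coefficient of `ω_j` in the simple root `α_r` (column `r` of the Cartan matrix). -/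
def cart (j r : ℕ) : ℤ :=
  if r = j then 2 else if r = j + 1 ∨ j = r + 1 then -1 else 0

/-- The weight `wt(A) = mω_i − Σ a_{p,q} α_{p,q}`, expressed in the basis of
fundamental weights: `wtv n i m A j` is the coefficient of `ω_j`. -/
def wtv (n i m : ℕ) (A : Arr) (j : ℕ) : ℤ :=
  (m : ℤ) * (if j = i then 1 else 0) -
    ∑ p ∈ Icc 1 i, ∑ q ∈ Icc i n, A p q * ∑ r ∈ Icc p q, cart j r

/-- The coefficient `c_l(p,q)` of the pairing `⟨α_l^∨, α_{p,q}⟩`. -/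
def clpq (l p q : ℕ) : ℤ :=
  if p = l ∧ q = l then 2
  else if (l = p ∧ p < q) ∨ (p < q ∧ q = l) then 1
  else if l + 1 = p ∨ l = q + 1 then -1
  else 0

/-- The pairing `⟨α_l^∨, wt(A)⟩ = m·δ_{l,i} − Σ_{p,q} a_{p,q}·c_l(p,q)`. -/
def pairing (n i m : ℕ) (l : ℕ) (A : Arr) : ℤ :=
  (m : ℤ) * (if l = i then 1 else 0) -
    ∑ p ∈ Icc 1 i, ∑ q ∈ Icc i n, A p q * clpq l p q

/-! ### The promotion algorithm -/

/-- Columns, indexed by rows `i,…,n`. -/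
abbrev Col := ℕ → ℤ

/-- `Σ_{j=lo}^{p} a_j + Σ_{j=p}^{n} b_j`. -/
def Gc (n lo : ℕ) (a b : Col) (p : ℕ) : ℤ := ∑ j ∈ Icc lo p, a j + ∑ j ∈ Icc p n, b j

/-- `q_−` for two (truncated) columns with rows `lo,…,n`: the minimal maximizer of `Gc`. -/
noncomputable def qmc (n lo : ℕ) (a b : Col) : ℕ :=
  if lo ≤ n then
    max lo (sInf {p | p ∈ Icc lo n ∧ ∀ q ∈ Icc lo n, Gc n lo a b q ≤ Gc n lo a b p})
  else n

/-- `ε` for two (truncated) columns with rows `lo,…,n`. -/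
noncomputable def epsc (n lo : ℕ) (a b : Col) : ℤ :=
  ∑ j ∈ Icc lo (qmc n lo a b), a j - ∑ j ∈ Icc lo (qmc n lo a b - 1), b j

/-- The sequence `l_1 < l_2 < ⋯` of the promotion algorithm:
`l_1 = q_−(a,c)` and `l_{s+1} = q_−((a)^{≥ l_s + 1}, (c)^{≥ l_s + 1})`,
stabilizing at `n`. -/
noncomputable def lfun (n i : ℕ) (a c : Col) : ℕ → ℕ
  | 0 => qmc n i a c
  | s + 1 => qmc n (lfun n i a c s + 1) a c

/-- The set `{l_1, …, l_t}` (with `l_t = n`). -/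
noncomputable def lset (n i : ℕ) (a c : Col) : Finset ℕ := (Finset.range (n + 1)).image (lfun n i a c)

/-- The new column `ĉ` of formula (6.2). -/
noncomputable def hatc (n i : ℕ) (a c : Col) : Col := fun r =>
  if r = n then a n + c n
  else if r ∈ lset n i a c then a r + c r - epsc n (r + 1) a c
  else a r

/-- The output column of one step of the promotion algorithm. -/
noncomputable def prcol (n i : ℕ) (a c : Col) : Col := fun r =>
  if r = i then epsc n i a c
  else if r - 1 ∈ lset n i a c then epsc n r a c
  else c (r - 1)

/-- The running columns of the promotion algorithm: `cseq 0` is the `i`-th column of `A`,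
and `cseq (k+1)` is obtained from the `(i−1−k)`-th column of `A` and `cseq k`. -/
noncomputable def cseq (n i : ℕ) (A : Arr) : ℕ → Col
  | 0 => fun r => A i r
  | k + 1 => hatc n i (fun r => A (i - 1 - k) r) (cseq n i A k)

/-- The `j`-th column of `pr(A)` for `2 ≤ j ≤ i`. -/
noncomputable def prColJ (n i : ℕ) (A : Arr) (j : ℕ) : Col :=
  prcol n i (fun q => A (j - 1) q) (cseq n i A (i - j))

/-- The promotion map `pr` on `B^{m,i}`. -/
noncomputable def prMap (n i m : ℕ) (A : Arr) : Arr := fun p r =>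
  if 1 ≤ p ∧ p ≤ i ∧ i ≤ r ∧ r ≤ n then
    if p = 1 then
      if r = i then
        (m : ℤ) - (∑ j ∈ Icc i n, A i j) - ∑ j ∈ Icc 2 i, prColJ n i A j i
      else
        (∑ j ∈ Icc 1 i, A j (r - 1)) - ∑ j ∈ Icc 2 i, prColJ n i A j r
    else prColJ n i A p r
  else 0

/-- The content `(r_1,…,r_{n+1})` of an array. -/
def cont (n i m : ℕ) (A : Arr) (k : ℕ) : ℤ :=
  if k ≤ i then (m : ℤ) - ∑ q ∈ Icc i n, A k q else ∑ p ∈ Icc 1 i, A p (k - 1)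

/-! ### Minimal maximizers and the recursion for `epsc` -/

lemma qmc_spec {n lo : ℕ} (h : lo ≤ n) (a b : Col) :
    qmc n lo a b ∈ Icc lo n ∧ (∀ q ∈ Icc lo n, Gc n lo a b q ≤ Gc n lo a b (qmc n lo a b)) := by
  have hne : {p | p ∈ Icc lo n ∧ ∀ q ∈ Icc lo n, Gc n lo a b q ≤ Gc n lo a b p}.Nonempty := by
    obtain ⟨p, hp, hq⟩ := Finset.exists_max_image (Icc lo n) (Gc n lo a b) ⟨lo, by simp [h]⟩
    exact ⟨p, hp, hq⟩
  have hmem := Nat.sInf_mem hne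
  have hlo := (Finset.mem_Icc.1 hmem.1).1
  rw [qmc, if_pos h, max_eq_right hlo]
  exact hmem

lemma qmc_eq {n lo p : ℕ} {a b : Col} (hp : p ∈ Icc lo n)
    (hmax : ∀ q ∈ Icc lo n, Gc n lo a b q ≤ Gc n lo a b p)
    (hmin : ∀ q ∈ Icc lo n, q < p → Gc n lo a b q < Gc n lo a b p) : qmc n lo a b = p := by
  have h : lo ≤ n := (Finset.mem_Icc.1 hp).1.trans (Finset.mem_Icc.1 hp).2
  obtain ⟨h1, h2⟩ := qmc_spec h a b
  have hle : qmc n lo a b ≤ p := by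
    rw [qmc, if_pos h]
    exact max_le (Finset.mem_Icc.1 hp).1 (Nat.sInf_le ⟨hp, hmax⟩)
  rcases hle.lt_or_eq with hlt | heq
  · exact absurd (h2 p hp) (not_le.2 (hmin _ h1 hlt))
  · exact heq

lemma Gc_lt_of_lt_qmc {n lo q : ℕ} {a b : Col} (hq : q ∈ Icc lo n) (hlt : q < qmc n lo a b) :
    Gc n lo a b q < Gc n lo a b (qmc n lo a b) := by
  have h : lo ≤ n := (Finset.mem_Icc.1 hq).1.trans (Finset.mem_Icc.1 hq).2
  obtain ⟨-, h2⟩ := qmc_spec h a b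
  by_contra! hcon
  have hmem : q ∈ {p | p ∈ Icc lo n ∧ ∀ q ∈ Icc lo n, Gc n lo a b q ≤ Gc n lo a b p} :=
    ⟨hq, fun x hx => (h2 x hx).trans hcon⟩
  have : qmc n lo a b ≤ q := by
    rw [qmc, if_pos h]
    exact max_le (Finset.mem_Icc.1 hq).1 (Nat.sInf_le hmem)
  omega

lemma sum_Icc_eq_add {f : ℕ → ℤ} {l n : ℕ} (h : l ≤ n) :
    ∑ j ∈ Icc l n, f j = f l + ∑ j ∈ Icc (l + 1) n, f j := by
  rw [← Finset.insert_Icc_add_one_left_eq_Icc h, Finset.sum_insert (by simp)]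

lemma Gc_self {n lo : ℕ} (a b : Col) : Gc n lo a b lo = a lo + ∑ j ∈ Icc lo n, b j := by
  simp [Gc]

lemma Gc_eq_add {n lo q : ℕ} (a b : Col) (h : lo ≤ q) :
    Gc n lo a b q = a lo + Gc n (lo + 1) a b q := by
  rw [Gc, Gc, sum_Icc_eq_add h, add_assoc]

lemma epsc_eq {n lo : ℕ} (h0 : 1 ≤ lo) (h : lo ≤ n) (a b : Col) :
    epsc n lo a b = Gc n lo a b (qmc n lo a b) - ∑ j ∈ Icc lo n, b j := by
  obtain ⟨h1, -⟩ := qmc_spec h a b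
  rw [Finset.mem_Icc] at h1
  obtain ⟨t, ht⟩ : ∃ t, qmc n lo a b = t + 1 := ⟨qmc n lo a b - 1, by omega⟩
  rw [epsc, Gc, ht, Nat.add_sub_cancel]
  have hsplit : ∑ j ∈ Icc lo n, b j = ∑ j ∈ Icc lo t, b j + ∑ j ∈ Icc (t + 1) n, b j := by
    rw [← Finset.sum_union]
    · congr 1
      ext x
      simp only [Finset.mem_union, Finset.mem_Icc]
      omega
    · rw [Finset.disjoint_left]
      intro x
      simp only [Finset.mem_Icc]
      omega
  rw [hsplit]
  ring

lemma qmc_self {n : ℕ} (a b : Col) : qmc n n a b = n := by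
  have h := (qmc_spec le_rfl a b : qmc n n a b ∈ Icc n n ∧ _).1
  rw [Finset.mem_Icc] at h
  omega

lemma qmc_of_epsc_le {n lo : ℕ} {a b : Col} (h : lo < n) (hle : epsc n (lo + 1) a b ≤ b lo) :
    qmc n lo a b = lo := by
  obtain ⟨-, h2⟩ := qmc_spec (show lo + 1 ≤ n from h) a b
  rw [epsc_eq (by omega) h] at hle
  have hs := sum_Icc_eq_add (f := b) h.le
  refine qmc_eq (by simp [h.le]) (fun q hq => ?_) (fun q hq hlt => ?_)
  · rw [Finset.mem_Icc] at hq
    rcases hq.1.eq_or_lt with rfl | hlt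
    · exact le_rfl
    · have := h2 q (by rw [Finset.mem_Icc]; omega)
      rw [Gc_self, Gc_eq_add a b hq.1]
      linarith
  · rw [Finset.mem_Icc] at hq
    omega

lemma qmc_of_lt_epsc {n lo : ℕ} {a b : Col} (h : lo < n) (hlt : b lo < epsc n (lo + 1) a b) :
    qmc n lo a b = qmc n (lo + 1) a b := by
  obtain ⟨h1, h2⟩ := qmc_spec (show lo + 1 ≤ n from h) a b
  rw [epsc_eq (by omega) h] at hlt
  have hs := sum_Icc_eq_add (f := b) h.le
  rw [Finset.mem_Icc] at h1
  refine qmc_eq (by rw [Finset.mem_Icc]; omega) (fun q hq => ?_) (fun q hq hq' => ?_)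
  · rw [Finset.mem_Icc] at hq
    rw [Gc_eq_add a b (show lo ≤ qmc n (lo + 1) a b by omega)]
    rcases hq.1.eq_or_lt with rfl | hl
    · rw [Gc_self]
      linarith
    · have := h2 q (by rw [Finset.mem_Icc]; omega)
      rw [Gc_eq_add a b hq.1]
      linarith
  · rw [Finset.mem_Icc] at hq
    rw [Gc_eq_add a b (show lo ≤ qmc n (lo + 1) a b by omega)]
    rcases hq.1.eq_or_lt with rfl | hl
    · rw [Gc_self]
      linarith
    · have := Gc_lt_of_lt_qmc (a := a) (b := b) (show q ∈ Icc (lo + 1) n by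
        rw [Finset.mem_Icc]; omega) hq'
      rw [Gc_eq_add a b hq.1]
      linarith

lemma qmc_eq_self_iff {n lo : ℕ} {a b : Col} (h : lo < n) :
    qmc n lo a b = lo ↔ epsc n (lo + 1) a b ≤ b lo := by
  refine ⟨fun he => ?_, qmc_of_epsc_le h⟩
  by_contra! hlt
  have h1 := (qmc_spec (show lo + 1 ≤ n from h) a b).1
  rw [← qmc_of_lt_epsc h hlt, he, Finset.mem_Icc] at h1
  omega

lemma epsc_self {n : ℕ} (h0 : 1 ≤ n) (a b : Col) : epsc n n a b = a n := by
  rw [epsc_eq h0 le_rfl, qmc_self, Gc_self]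
  ring

lemma epsc_rec {n lo : ℕ} (h0 : 1 ≤ lo) (h : lo < n) (a b : Col) :
    epsc n lo a b = a lo + epsc n (lo + 1) a b - min (b lo) (epsc n (lo + 1) a b) := by
  have hs := sum_Icc_eq_add (f := b) h.le
  rcases le_or_gt (epsc n (lo + 1) a b) (b lo) with hle | hlt
  · rw [min_eq_right hle, epsc_eq h0 h.le, qmc_of_epsc_le h hle, Gc_self]
    ring
  · have h1 := (qmc_spec (show lo + 1 ≤ n from h) a b).1
    rw [Finset.mem_Icc] at h1
    rw [min_eq_left hlt.le, epsc_eq h0 h.le, qmc_of_lt_epsc h hlt, epsc_eq (by omega) h,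
      Gc_eq_add a b (by omega), hs]
    ring

/-! ### The set of break points -/

lemma qmc_eq_of_mem {n lo r : ℕ} {a b : Col} (hn : lo ≤ n) (h : lo ≤ r)
    (hr : r ≤ qmc n lo a b) : qmc n r a b = qmc n lo a b := by
  have hle := (Finset.mem_Icc.1 (qmc_spec hn a b).1).2
  induction r, h using Nat.le_induction with
  | base => rfl
  | succ r h ih =>
    have ih := ih (by omega)
    rw [← ih]
    refine (qmc_of_lt_epsc (by omega) ?_).symm
    by_contra! hcon
    have := qmc_of_epsc_le (show r < n by omega) hcon
    omega

lemma qmc_add_one_self {n : ℕ} (a b : Col) : qmc n (n + 1) a b = n := by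
  simp [qmc]

lemma qmc_succ_spec {n l : ℕ} (h : l ≤ n) (a b : Col) :
    l ≤ qmc n (l + 1) a b ∧ qmc n (l + 1) a b ≤ n ∧
      qmc n (qmc n (l + 1) a b) a b = qmc n (l + 1) a b := by
  rcases h.eq_or_lt with rfl | hlt
  · rw [qmc_add_one_self, qmc_self]
    simp
  · have h1 := Finset.mem_Icc.1 (qmc_spec (show l + 1 ≤ n from hlt) a b).1
    exact ⟨by omega, h1.2, qmc_eq_of_mem hlt h1.1 le_rfl⟩

lemma lfun_spec {n i : ℕ} (h : i ≤ n) (a c : Col) (s : ℕ) :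
    i ≤ lfun n i a c s ∧ lfun n i a c s ≤ n ∧
      qmc n (lfun n i a c s) a c = lfun n i a c s := by
  induction s with
  | zero =>
    have h1 := Finset.mem_Icc.1 (qmc_spec h a c).1
    exact ⟨h1.1, h1.2, qmc_eq_of_mem h h1.1 le_rfl⟩
  | succ s ih =>
    have h1 := qmc_succ_spec ih.2.1 a c
    exact ⟨ih.1.trans h1.1, h1.2⟩

lemma qmc_le_of_fixed {n lo r : ℕ} {a c : Col} (h : lo ≤ r) (hn : r ≤ n)
    (hr : qmc n r a c = r) : qmc n lo a c ≤ r := by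
  by_contra! hcon
  have := qmc_eq_of_mem (h.trans hn) h hcon.le
  omega

lemma exists_lfun_eq_or {n i r : ℕ} {a c : Col} (h : i ≤ r) (hn : r ≤ n)
    (hr : qmc n r a c = r) (s : ℕ) :
    (∃ t ≤ s, lfun n i a c t = r) ∨ (lfun n i a c s < r ∧ s ≤ lfun n i a c s) := by
  induction s with
  | zero =>
    rcases (qmc_le_of_fixed h hn hr).eq_or_lt with heq | hlt
    · exact Or.inl ⟨0, le_rfl, heq⟩
    · exact Or.inr ⟨hlt, Nat.zero_le _⟩
  | succ s ih =>
    rcases ih with ⟨t, ht, he⟩ | ⟨h1, h2⟩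
    · exact Or.inl ⟨t, by omega, he⟩
    · have hmem := Finset.mem_Icc.1
        (qmc_spec (show lfun n i a c s + 1 ≤ n by omega) a c).1
      rcases (qmc_le_of_fixed (show lfun n i a c s + 1 ≤ r from h1) hn hr).eq_or_lt with heq | hlt
      · exact Or.inl ⟨s + 1, le_rfl, heq⟩
      · refine Or.inr ⟨hlt, ?_⟩
        change s + 1 ≤ qmc n (lfun n i a c s + 1) a c
        omega

lemma mem_lset_iff {n i r : ℕ} {a c : Col} (h : i ≤ r) (hn : r ≤ n) :
    r ∈ lset n i a c ↔ qmc n r a c = r := by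
  rw [lset, Finset.mem_image]
  constructor
  · rintro ⟨s, -, rfl⟩
    exact (lfun_spec (h.trans hn) a c s).2.2
  · intro hr
    rcases exists_lfun_eq_or h hn hr n with ⟨t, ht, he⟩ | ⟨h1, h2⟩
    · exact ⟨t, by simp; omega, he⟩
    · omega

/-! ### One step of the promotion algorithm -/

lemma hatc_eq {n i r : ℕ} (a c : Col) (h : i ≤ r) (hn : r < n) :
    hatc n i a c r = a r + c r - min (c r) (epsc n (r + 1) a c) := by
  simp only [hatc, if_neg hn.ne, mem_lset_iff h hn.le, qmc_eq_self_iff hn]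
  split_ifs with hle
  · rw [min_eq_right hle]
  · rw [min_eq_left (not_le.1 hle).le]
    ring

lemma prcol_succ_eq {n i r : ℕ} (a c : Col) (h : i ≤ r) (hn : r < n) :
    prcol n i a c (r + 1) = min (c r) (epsc n (r + 1) a c) := by
  rw [prcol, if_neg (by omega)]
  simp only [Nat.add_sub_cancel, mem_lset_iff h hn.le, qmc_eq_self_iff hn]
  split_ifs with hle
  · rw [min_eq_right hle]
  · rw [min_eq_left (not_le.1 hle).le]

lemma hatc_last {n i : ℕ} (a c : Col) : hatc n i a c n = a n + c n := if_pos rfl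

lemma sum_hatc {n i s : ℕ} (h0 : 1 ≤ i) (a c : Col) (h : i ≤ s) (hn : s ≤ n) :
    ∑ r ∈ Icc s n, hatc n i a c r = epsc n s a c + ∑ r ∈ Icc s n, c r := by
  induction hn using Nat.decreasingInduction with
  | self => simp [hatc_last, epsc_self (h0.trans h)]
  | of_succ s hs ih =>
    rw [sum_Icc_eq_add hs.le, sum_Icc_eq_add hs.le, ih (by omega), hatc_eq a c h hs,
      epsc_rec (h0.trans h) hs]
    ring

/-! ### Iterating the step -/

lemma cseq_succ (n i : ℕ) (A : Arr) (k : ℕ) :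
    cseq n i A (k + 1) = hatc n i (fun r => A (i - 1 - k) r) (cseq n i A k) := rfl

lemma sum_Icc_sub_eq (f : ℕ → ℤ) {i k : ℕ} (h : k < i) :
    ∑ j ∈ Icc (i - k) i, f j = ∑ t ∈ range (k + 1), f (i - t) := by
  induction k with
  | zero => simp
  | succ k ih =>
    rw [Finset.sum_range_succ, ← ih (by omega), sum_Icc_eq_add (by omega),
      show i - (k + 1) + 1 = i - k by omega]
    ring

lemma cseq_add_sum_prColJ {n i r : ℕ} (A : Arr) (h : i ≤ r) (hn : r < n) {k : ℕ} (hk : k < i) :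
    cseq n i A k r + ∑ t ∈ range k, prColJ n i A (i - t) (r + 1) =
      ∑ t ∈ range (k + 1), A (i - t) r := by
  induction k with
  | zero => simp [cseq]
  | succ k ih =>
    have ih := ih (by omega)
    rw [Finset.sum_range_succ, Finset.sum_range_succ _ (k + 1), ← ih, cseq_succ, prColJ,
      prcol_succ_eq _ _ h hn, hatc_eq _ _ h hn, show i - (i - k) = k by omega,
      show i - k - 1 = i - (k + 1) by omega, show i - 1 - k = i - (k + 1) by omega]
    ring

lemma cseq_last {n i : ℕ} (A : Arr) {k : ℕ} (hk : k < i) :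
    cseq n i A k n = ∑ t ∈ range (k + 1), A (i - t) n := by
  induction k with
  | zero => simp [cseq]
  | succ k ih =>
    rw [Finset.sum_range_succ, ← ih (by omega), cseq_succ, hatc_last,
      show i - 1 - k = i - (k + 1) by omega]
    ring

lemma sum_cseq {n i : ℕ} (A : Arr) (h0 : 1 ≤ i) (hin : i ≤ n) {k : ℕ} (hk : k < i) :
    ∑ r ∈ Icc i n, cseq n i A k r =
      ∑ r ∈ Icc i n, A i r + ∑ t ∈ range k, prColJ n i A (i - t) i := by
  induction k with
  | zero => simp [cseq]
  | succ k ih =>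
    rw [Finset.sum_range_succ, ← add_assoc, ← ih (by omega), cseq_succ,
      sum_hatc h0 _ _ le_rfl hin, prColJ, prcol, if_pos rfl, show i - (i - k) = k by omega,
      show i - k - 1 = i - 1 - k by omega]
    ring

lemma cseq_nonneg {n i m : ℕ} {A : Arr} (hA : InB n i m A) {k r : ℕ} (hk : k < i)
    (h : i ≤ r) (hn : r < n) : 0 ≤ cseq n i A k r := by
  cases k with
  | zero => exact hA.1 i r (by omega) le_rfl h hn.le
  | succ k =>
    have := hA.1 (i - 1 - k) r (by omega) (by omega) h hn.le
    rw [cseq_succ, hatc_eq _ _ h hn]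
    have := min_le_left (cseq n i A k r) (epsc n (r + 1) (fun r => A (i - 1 - k) r) (cseq n i A k))
    linarith

/-! ### Dyck paths realizing the column sums -/

/-- There is a lattice path from `(p, q)` to `(i, n)` along which the entries of `A` sum to `v`. -/
def HasPath (n i : ℕ) (A : Arr) (p q : ℕ) (v : ℤ) : Prop :=
  ∃ T : List (ℕ × ℕ), ((p, q) :: T).getLast? = some (i, n) ∧
    ((p, q) :: T).IsChain (fun β γ => γ = (β.1, β.2 + 1) ∨ γ = (β.1 + 1, β.2)) ∧
    (((p, q) :: T).map fun β => A β.1 β.2).sum = v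

lemma hasPath_self (n i : ℕ) (A : Arr) : HasPath n i A i n (A i n) :=
  ⟨[], by simp, by simp, by simp⟩

lemma HasPath.cons {n i p q p' q' : ℕ} {A : Arr} {v : ℤ} (h : HasPath n i A p' q' v)
    (hstep : (p', q') = (p, q + 1) ∨ (p', q') = (p + 1, q)) :
    HasPath n i A p q (A p q + v) := by
  obtain ⟨T, h1, h2, h3⟩ := h
  refine ⟨(p', q') :: T, by simpa using h1, ?_, ?_⟩
  · exact List.isChain_cons_cons.2 ⟨hstep, h2⟩
  · rw [List.map_cons, List.sum_cons, h3]

lemma HasPath.le {n i m : ℕ} {A : Arr} {v : ℤ} (hA : InB n i m A) (h : HasPath n i A 1 i v) :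
    v ≤ m := by
  obtain ⟨T, h1, h2, rfl⟩ := h
  exact hA.2.2 _ ⟨by simp, by simp, h1, h2⟩

lemma hasPath_sum_cseq {n i : ℕ} (A : Arr) (h0 : 1 ≤ i) {k : ℕ} (hk : k < i) :
    ∀ s, i ≤ s → s ≤ n → HasPath n i A (i - k) s (∑ r ∈ Icc s n, cseq n i A k r) := by
  induction k with
  | zero =>
    intro s hs hsn
    induction hsn using Nat.decreasingInduction with
    | self => simpa [cseq] using hasPath_self n i A
    | of_succ s hlt ih =>
      rw [sum_Icc_eq_add hlt.le]
      exact (ih (by omega)).cons (Or.inl rfl)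
  | succ k ihk =>
    intro s hs hsn
    have hcol : i - 1 - k = i - (k + 1) := by omega
    have hright : ∀ s : ℕ, (i - k, s) = (i - (k + 1) + 1, s) := fun s => by
      rw [show i - k = i - (k + 1) + 1 by omega]
    induction hsn using Nat.decreasingInduction with
    | self =>
      have h := (ihk (by omega) n hs le_rfl).cons (Or.inr (hright n))
      rw [Icc_self, sum_singleton, ← hcol] at h ⊢
      rwa [cseq_succ, hatc_last]
    | of_succ s hlt ih =>
      rcases le_or_gt (epsc n (s + 1) (fun r => A (i - 1 - k) r) (cseq n i A k))
        (cseq n i A k s) with hle | hgt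
      · have h := (ihk (by omega) s hs hlt.le).cons (Or.inr (hright s))
        convert h using 1
        rw [cseq_succ, sum_hatc h0 _ _ hs hlt.le, epsc_rec (by omega) hlt, min_eq_right hle, hcol]
        ring
      · have h := (ih (by omega)).cons (p := i - (k + 1)) (q := s) (Or.inl rfl)
        convert h using 1
        rw [sum_Icc_eq_add hlt.le, cseq_succ, hatc_eq _ _ hs hlt, min_eq_left hgt.le, hcol]
        ring

/-! ### The first column -/

lemma prMap_one_first {n i m : ℕ} (hi : 2 ≤ i) (hin : i ≤ n) (A : Arr) :
    prMap n i m A 1 i = m - ∑ r ∈ Icc i n, cseq n i A (i - 1) r := by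
  have h := sum_Icc_sub_eq (fun j => prColJ n i A j i) (show i - 2 < i by omega)
  rw [show i - (i - 2) = 2 by omega, show i - 2 + 1 = i - 1 by omega] at h
  rw [prMap, if_pos (by omega), if_pos rfl, if_pos rfl, h,
    sum_cseq A (by omega) hin (by omega)]
  ring

lemma prMap_one_succ {n i m r : ℕ} (hi : 2 ≤ i) (A : Arr) (h : i ≤ r) (hn : r < n) :
    prMap n i m A 1 (r + 1) = cseq n i A (i - 1) r := by
  have h1 := sum_Icc_sub_eq (fun j => prColJ n i A j (r + 1)) (show i - 2 < i by omega)
  rw [show i - (i - 2) = 2 by omega, show i - 2 + 1 = i - 1 by omega] at h1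
  have h2 := sum_Icc_sub_eq (fun j => A j r) (show i - 1 < i by omega)
  rw [show i - (i - 1) = 1 by omega] at h2
  rw [prMap, if_pos (by omega), if_pos rfl, if_neg (by omega), Nat.add_sub_cancel, h1, h2,
    ← cseq_add_sum_prColJ A h hn (by omega)]
  ring

lemma sum_prMap_one {n i m s : ℕ} (hi : 2 ≤ i) (A : Arr) (h : i ≤ s) (hn : s ≤ n) :
    ∑ r ∈ Icc (s + 1) n, prMap n i m A 1 r + cseq n i A (i - 1) n =
      ∑ r ∈ Icc s n, cseq n i A (i - 1) r := by
  induction hn using Nat.decreasingInduction with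
  | self => simp
  | of_succ s hs ih =>
    rw [sum_Icc_eq_add (f := cseq n i A (i - 1)) hs.le, ← ih (by omega),
      sum_Icc_eq_add (l := s + 1) hs, prMap_one_succ hi A h hs]
    ring

/-- The first column produced by the promotion algorithm has
nonnegative entries, and `m − Σ_{r=i}^{n} pr(A)_{1,r} = Σ_{r=1}^{i} a_{r,n}`. -/
theorem stmt13 (n i m : ℕ) (hi : 2 ≤ i) (hin : i ≤ n) (A : Arr) (hA : InB n i m A) :
    (∀ r ∈ Finset.Icc i n, 0 ≤ prMap n i m A 1 r) ∧
    ((m : ℤ) - ∑ r ∈ Finset.Icc i n, prMap n i m A 1 r =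
      ∑ r ∈ Finset.Icc 1 i, A r n) := by
  constructor
  · intro r hr
    rw [Finset.mem_Icc] at hr
    rcases hr.1.eq_or_lt with rfl | hlt
    · have h := hasPath_sum_cseq (n := n) A (by omega) (show i - 1 < i by omega) i le_rfl hin
      rw [show i - (i - 1) = 1 by omega] at h
      have := h.le hA
      rw [prMap_one_first hi hin]
      linarith
    · obtain ⟨r, rfl⟩ : ∃ t, r = t + 1 := ⟨r - 1, by omega⟩
      rw [prMap_one_succ hi A (by omega) (by omega)]
      exact cseq_nonneg hA (by omega) (by omega) (by omega)
  · have h1 := sum_prMap_one (m := m) hi A le_rfl hin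
    have h2 := cseq_last (n := n) A (show i - 1 < i by omega)
    have h3 := sum_Icc_sub_eq (fun j => A j n) (show i - 1 < i by omega)
    rw [show i - (i - 1) = 1 by omega] at h3
    rw [sum_Icc_eq_add hin, prMap_one_first hi hin, h3, ← h2, ← h1]
    ring

end KR
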